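/- arXiv:math/0509641 — 3 statements merged into one kernel-verified Lean document; each statement's English description precedes it below -/
import Mathlib

section
/- Let a ≥ 1, b ≥ 0 and let Λ = U^a ⊕ E₈(−1)^b, an even unimodular lattice of signature (a, a+8b). Then the group O⁺(Λ) of isometries of Λ that preserve the orientation of maximal positive-definite subspaces acts transitively on the set {δ ∈ Λ : ⟨δ,δ⟩ = −2} of norm −2 vectors. (Consequently the discriminant locus, the union over such δ of the sets of maximal positive subspaces orthogonal to δ, is a single O⁺(Λ)-orbit, i.e. irreducible.) -/
noncomputable section

open scoped BigOperators

/-- Index type for the even unimodular lattice `U^a ⊕ E₈(-1)^b`. -/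
abbrev LIdx (a b : ℕ) := (Fin a × Fin 2) ⊕ (Fin b × Fin 8)

/-- Elements of the lattice `U^a ⊕ E₈(-1)^b`, written in coordinates. -/
abbrev LVec (a b : ℕ) := LIdx a b → ℤ

/-- The Gram matrix of `U^a ⊕ E₈(-1)^b`: each `U`-summand is a hyperbolic plane and each
`E₈(-1)`-summand carries the negative of the `E₈` Cartan matrix; distinct summands are
orthogonal. -/
def gramL (a b : ℕ) : LIdx a b → LIdx a b → ℤ := fun i j =>
  match i, j with
  | Sum.inl (k, s), Sum.inl (k', s') => if k = k' ∧ s ≠ s' then 1 else 0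
  | Sum.inr (k, s), Sum.inr (k', s') => if k = k' then -(CartanMatrix.E₈ s s') else 0
  | _, _ => 0

/-- The bilinear form of `U^a ⊕ E₈(-1)^b`. -/
def BL (a b : ℕ) (x y : LVec a b) : ℤ :=
  ∑ i, ∑ j, x i * gramL a b i j * y j

/-- The ℝ-bilinear extension of the form of `U^a ⊕ E₈(-1)^b` to `(U^a ⊕ E₈(-1)^b) ⊗ ℝ`. -/
def BLR (a b : ℕ) (x y : LIdx a b → ℝ) : ℝ :=
  ∑ i, ∑ j, x i * (gramL a b i j : ℝ) * y j

/-- The ℝ-linear extension of a ℤ-linear automorphism of `ι → ℤ` to `ι → ℝ`. -/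
def realExt {ι : Type} [Fintype ι] [DecidableEq ι] (φ : (ι → ℤ) ≃ₗ[ℤ] (ι → ℤ)) :
    (ι → ℝ) →ₗ[ℝ] (ι → ℝ) :=
  Matrix.toLin'
    ((LinearMap.toMatrix' (φ : (ι → ℤ) →ₗ[ℤ] (ι → ℤ))).map fun z : ℤ => (z : ℝ))

/-- An isometry `φ` of `U^a ⊕ E₈(-1)^b` preserves the orientation of (maximal)
positive-definite subspaces: for some `a`-dimensional subspace `P` of `Λ ⊗ ℝ` on which the
form is positive definite, the composite of the real extension of `φ` restricted to `P`
with the orthogonal (with respect to the form) projection back onto `P` has positive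
determinant. -/
def PresOrient (a b : ℕ) (φ : LVec a b ≃ₗ[ℤ] LVec a b) : Prop :=
  ∃ P : Submodule ℝ (LIdx a b → ℝ),
    Module.finrank ℝ P = a ∧
    (∀ v ∈ P, v ≠ 0 → 0 < BLR a b v v) ∧
    ∃ proj : (LIdx a b → ℝ) →ₗ[ℝ] P,
      (∀ p : P, proj (p : LIdx a b → ℝ) = p) ∧
      (∀ v : LIdx a b → ℝ, ∀ p ∈ P, BLR a b (v - (proj v : LIdx a b → ℝ)) p = 0) ∧
      0 < LinearMap.det (proj ∘ₗ realExt φ ∘ₗ P.subtype)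

section Lattices

variable {E : Type*} [AddCommGroup E] [Module ℚ E]

/-- `L` is an even lattice of full rank that contains its dual, hence equals it. -/
structure IsEvenSelfDual (B : E →ₗ[ℚ] E →ₗ[ℚ] ℚ) (L : AddSubgroup E) : Prop where
  even : ∀ x ∈ L, ∃ k : ℤ, B x x = 2 * k
  dual : ∀ x, (∀ y ∈ L, ∃ k : ℤ, B x y = k) → x ∈ L
  full : ∀ x, ∃ m : ℤ, m ≠ 0 ∧ m • x ∈ L

theorem IsEvenSelfDual.integral {B : E →ₗ[ℚ] E →ₗ[ℚ] ℚ} {L : AddSubgroup E}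
    (hL : IsEvenSelfDual B L) (hB : ∀ x y, B x y = B y x) {x y : E} (hx : x ∈ L) (hy : y ∈ L) :
    ∃ k : ℤ, B x y = k := by
  obtain ⟨i, hi⟩ := hL.even x hx
  obtain ⟨j, hj⟩ := hL.even y hy
  obtain ⟨k, hk⟩ := hL.even _ (L.add_mem hx hy)
  refine ⟨k - i - j, ?_⟩
  simp only [map_add, LinearMap.add_apply, hB y x] at hk
  push_cast
  linarith

theorem IsEvenSelfDual.comap {F : Type*} [AddCommGroup F] [Module ℚ F]
    {B : E →ₗ[ℚ] E →ₗ[ℚ] ℚ} {C : F →ₗ[ℚ] F →ₗ[ℚ] ℚ} {L : AddSubgroup F}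
    (hL : IsEvenSelfDual C L) (g : E ≃ₗ[ℚ] F) (hg : ∀ x y, C (g x) (g y) = B x y) :
    IsEvenSelfDual B (L.comap (g : E →+ F)) where
  even x hx := by simpa [hg] using hL.even (g x) hx
  dual x hx := by
    refine hL.dual (g x) fun y hy => ?_
    have := hx (g.symm y) (by simpa using hy)
    rwa [← hg, g.apply_symm_apply] at this
  full x := by
    obtain ⟨m, hm, h⟩ := hL.full (g x)
    exact ⟨m, hm, by simpa using h⟩

/-- A vector of norm `-2` pairs to `1` with some lattice vector. -/
theorem IsEvenSelfDual.exists_pairing_eq_one {B : E →ₗ[ℚ] E →ₗ[ℚ] ℚ} {L : AddSubgroup E}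
    (hL : IsEvenSelfDual B L) (hB : ∀ x y, B x y = B y x) {r : E} (hr : r ∈ L)
    (hrr : B r r = -2) : ∃ z ∈ L, B z r = 1 := by
  let S : AddSubgroup ℤ :=
    (L.map (B r : E →+ ℚ)).comap (Int.castAddHom ℚ)
  obtain ⟨d, hd⟩ := Int.subgroup_cyclic S
  have key : ∀ k : ℤ, k ∈ S ↔ d ∣ k := fun k => by
    rw [hd, AddSubgroup.mem_closure_singleton]
    exact ⟨fun ⟨n, hn⟩ => ⟨n, by rw [← hn, smul_eq_mul, mul_comm]⟩,
      fun ⟨n, hn⟩ => ⟨n, by rw [hn, smul_eq_mul, mul_comm]⟩⟩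
  have h2 : d ∣ -2 := (key _).1 ⟨r, hr, by simpa using hrr⟩
  have hd0 : (d : ℚ) ≠ 0 := by
    rintro h
    rw [Int.cast_eq_zero.1 h] at h2
    simp at h2
  have hmem : (d : ℚ)⁻¹ • r ∈ L := by
    refine hL.dual _ fun y hy => ?_
    obtain ⟨k, hk⟩ := hL.integral hB hr hy
    obtain ⟨n, hn⟩ := (key k).1 ⟨y, hy, by simpa using hk⟩
    refine ⟨n, ?_⟩
    simp only [map_smul, LinearMap.smul_apply, hk, hn, smul_eq_mul]
    push_cast
    field_simp
  obtain ⟨k, hk⟩ := hL.even _ hmem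
  have h1 : d * d * k = -1 := by
    simp only [map_smul, LinearMap.smul_apply, hrr, smul_eq_mul] at hk
    field_simp at hk
    have : (d * d * k : ℚ) = -1 := by linarith
    exact_mod_cast this
  have h1' : d ∣ 1 := ⟨-(d * k), by linarith⟩
  obtain ⟨z, hz, hz'⟩ := (key 1).2 h1'
  exact ⟨z, hz, by rw [hB]; simpa using hz'⟩

end Lattices

section Hyperbolic

variable {V : Type*} [AddCommGroup V] [Module ℚ V]

/-- The orthogonal sum of a rational hyperbolic plane and the form `B`. -/
def hypForm (B : V →ₗ[ℚ] V →ₗ[ℚ] ℚ) : (ℚ × ℚ × V) →ₗ[ℚ] (ℚ × ℚ × V) →ₗ[ℚ] ℚ :=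
  LinearMap.mk₂ ℚ (fun x y => x.1 * y.2.1 + x.2.1 * y.1 + B x.2.2 y.2.2)
    (fun x y z => by simp; ring) (fun c x y => by simp; ring)
    (fun x y z => by simp; ring) (fun c x y => by simp; ring)

@[simp]
theorem hypForm_apply (B : V →ₗ[ℚ] V →ₗ[ℚ] ℚ) (x y : ℚ × ℚ × V) :
    hypForm B x y = x.1 * y.2.1 + x.2.1 * y.1 + B x.2.2 y.2.2 := rfl

/-- The lattice `U ⊕ N`. -/
def hypLattice (N : AddSubgroup V) : AddSubgroup (ℚ × ℚ × V) :=
  (Int.castAddHom ℚ).range.prod ((Int.castAddHom ℚ).range.prod N)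

theorem mem_hypLattice {V : Type*} [AddCommGroup V] {N : AddSubgroup V} {w : ℚ × ℚ × V} :
    w ∈ hypLattice N ↔ (∃ k : ℤ, w.1 = k) ∧ (∃ k : ℤ, w.2.1 = k) ∧ w.2.2 ∈ N := by
  simp only [hypLattice, AddSubgroup.mem_prod, AddMonoidHom.mem_range, Int.coe_castAddHom,
    @eq_comm _ (Int.cast _)]

theorem IsEvenSelfDual.add_plane {B : V →ₗ[ℚ] V →ₗ[ℚ] ℚ} {N : AddSubgroup V}
    (hN : IsEvenSelfDual B N) : IsEvenSelfDual (hypForm B) (hypLattice N) where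
  even x hx := by
    obtain ⟨⟨i, hi⟩, ⟨j, hj⟩, h⟩ := mem_hypLattice.1 hx
    obtain ⟨k, hk⟩ := hN.even _ h
    exact ⟨i * j + k, by simp only [hypForm_apply, hi, hj, hk]; push_cast; ring⟩
  dual x hx := by
    refine mem_hypLattice.2 ⟨?_, ?_, hN.dual _ fun y hy => ?_⟩
    · simpa using hx (0, 1, 0) (mem_hypLattice.2 ⟨⟨0, by simp⟩, ⟨1, by simp⟩, N.zero_mem⟩)
    · simpa using hx (1, 0, 0) (mem_hypLattice.2 ⟨⟨1, by simp⟩, ⟨0, by simp⟩, N.zero_mem⟩)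
    · simpa using hx (0, 0, y) (mem_hypLattice.2 ⟨⟨0, by simp⟩, ⟨0, by simp⟩, hy⟩)
  full x := by
    obtain ⟨m, hm, h⟩ := hN.full x.2.2
    refine ⟨x.1.den * x.2.1.den * m, by simp [hm], mem_hypLattice.2 ⟨?_, ?_, ?_⟩⟩
    · refine ⟨x.1.num * x.2.1.den * m, ?_⟩
      have := Rat.mul_den_eq_num x.1
      simp only [Prod.smul_fst, zsmul_eq_mul]
      push_cast
      rw [← this]
      ring
    · refine ⟨x.2.1.num * x.1.den * m, ?_⟩
      have := Rat.mul_den_eq_num x.2.1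
      simp only [Prod.smul_snd, Prod.smul_fst, zsmul_eq_mul]
      push_cast
      rw [← this]
      ring
    · simpa only [Prod.smul_snd, mul_smul] using N.zsmul_mem (N.zsmul_mem h _) _

/-- Exchange of the two isotropic generators of the hyperbolic plane. -/
def hypSwap : (ℚ × ℚ × V) ≃ₗ[ℚ] (ℚ × ℚ × V) where
  toFun w := (w.2.1, w.1, w.2.2)
  invFun w := (w.2.1, w.1, w.2.2)
  map_add' _ _ := rfl
  map_smul' _ _ := rfl
  left_inv _ := rfl
  right_inv _ := rfl

/-- Scaling the two isotropic generators by inverse factors. -/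
def hypScale (t : ℚ) (ht : t ≠ 0) : (ℚ × ℚ × V) ≃ₗ[ℚ] (ℚ × ℚ × V) where
  toFun w := (t⁻¹ * w.1, t * w.2.1, w.2.2)
  invFun w := (t * w.1, t⁻¹ * w.2.1, w.2.2)
  map_add' x y := by simp [mul_add]
  map_smul' c x := by simp [mul_left_comm]
  left_inv x := by simp [ht]
  right_inv x := by simp [ht]

/-- The Eichler transvection fixing the first isotropic generator. -/
def eichler (B : V →ₗ[ℚ] V →ₗ[ℚ] ℚ) (z : V) : (ℚ × ℚ × V) ≃ₗ[ℚ] (ℚ × ℚ × V) where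
  toFun w := (w.1 - B z w.2.2 - w.2.1 * B z z / 2, w.2.1, w.2.2 + w.2.1 • z)
  invFun w := (w.1 + B z w.2.2 - w.2.1 * B z z / 2, w.2.1, w.2.2 - w.2.1 • z)
  map_add' x y := by
    ext
    · simp; ring
    · simp
    · simp only [Prod.snd_add, Prod.fst_add]; module
  map_smul' c x := by
    ext
    · simp; ring
    · simp
    · simp only [Prod.smul_snd, Prod.smul_fst, smul_eq_mul, RingHom.id_apply]; module
  left_inv x := by
    ext <;> simp
    ring
  right_inv x := by
    ext <;> simp
    ring

theorem hypSwap_apply (w : ℚ × ℚ × V) : hypSwap w = (w.2.1, w.1, w.2.2) := rfl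

theorem hypScale_apply (t : ℚ) (ht : t ≠ 0) (w : ℚ × ℚ × V) :
    hypScale t ht w = (t⁻¹ * w.1, t * w.2.1, w.2.2) := rfl

theorem eichler_apply (B : V →ₗ[ℚ] V →ₗ[ℚ] ℚ) (z : V) (w : ℚ × ℚ × V) :
    eichler B z w = (w.1 - B z w.2.2 - w.2.1 * B z z / 2, w.2.1, w.2.2 + w.2.1 • z) := rfl

variable {B : V →ₗ[ℚ] V →ₗ[ℚ] ℚ}

theorem hypForm_symm (hB : ∀ x y, B x y = B y x) (x y : ℚ × ℚ × V) :
    hypForm B x y = hypForm B y x := by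
  simp [hB x.2.2]; ring

theorem hypForm_hypSwap (x y : ℚ × ℚ × V) :
    hypForm B (hypSwap x) (hypSwap y) = hypForm B x y := by
  simp [hypSwap_apply]; ring

theorem hypForm_hypScale (t : ℚ) (ht : t ≠ 0) (x y : ℚ × ℚ × V) :
    hypForm B (hypScale t ht x) (hypScale t ht y) = hypForm B x y := by
  simp [hypScale_apply]; field_simp

theorem hypForm_eichler (hB : ∀ x y, B x y = B y x) (z : V) (x y : ℚ × ℚ × V) :
    hypForm B (eichler B z x) (eichler B z y) = hypForm B x y := by
  simp [eichler_apply, hB _ z]; ring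

/-- Some isometry of `U ⊕ V` carries the pair `(L, u)` to the pair `(L', u')`. -/
def HypEquiv (B : V →ₗ[ℚ] V →ₗ[ℚ] ℚ) (L L' : AddSubgroup (ℚ × ℚ × V)) (u u' : ℚ × ℚ × V) : Prop :=
  ∃ g : (ℚ × ℚ × V) ≃ₗ[ℚ] (ℚ × ℚ × V), (∀ x y, hypForm B (g x) (g y) = hypForm B x y) ∧
    (∀ w, g w ∈ L' ↔ w ∈ L) ∧ g u = u'

theorem HypEquiv.trans {L L' L'' : AddSubgroup (ℚ × ℚ × V)} {u u' u'' : ℚ × ℚ × V}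
    (h : HypEquiv B L L' u u') (h' : HypEquiv B L' L'' u' u'') : HypEquiv B L L'' u u'' := by
  obtain ⟨g, hg, hgL, hgu⟩ := h
  obtain ⟨k, hk, hkL, hku⟩ := h'
  exact ⟨g.trans k, by simp only [LinearEquiv.trans_apply, hk, hg, implies_true],
    by simp only [LinearEquiv.trans_apply, hkL, hgL, implies_true],
    by rw [LinearEquiv.trans_apply, hgu, hku]⟩

theorem hypEquiv_comap_symm (g : (ℚ × ℚ × V) ≃ₗ[ℚ] (ℚ × ℚ × V))
    (hg : ∀ x y, hypForm B (g x) (g y) = hypForm B x y) (L : AddSubgroup (ℚ × ℚ × V))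
    (u : ℚ × ℚ × V) :
    HypEquiv B L (L.comap (g.symm : (ℚ × ℚ × V) →+ (ℚ × ℚ × V))) u (g u) :=
  ⟨g, hg, fun w => by simp, rfl⟩

/-- The lattice `(e^⊥ ∩ L) / (ℚe ∩ L)`, where `e` is the first isotropic generator. -/
def cuspLattice (L : AddSubgroup (ℚ × ℚ × V)) : AddSubgroup V where
  carrier := {y | ∃ c, (c, 0, y) ∈ L}
  zero_mem' := ⟨0, L.zero_mem⟩
  add_mem' := fun ⟨c, hc⟩ ⟨d, hd⟩ => ⟨c + d, by simpa using L.add_mem hc hd⟩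
  neg_mem' := fun ⟨c, hc⟩ => ⟨-c, by simpa using L.neg_mem hc⟩

theorem mem_cuspLattice {V : Type*} [AddCommGroup V] {L : AddSubgroup (ℚ × ℚ × V)} {y : V} :
    y ∈ cuspLattice L ↔ ∃ c, (c, 0, y) ∈ L := Iff.rfl

/-- A self-dual lattice contains `t e` and a vector pairing to `1` with it. -/
theorem IsEvenSelfDual.exists_dual_pair {L : AddSubgroup (ℚ × ℚ × V)}
    (hL : IsEvenSelfDual (hypForm B) L) (hB : ∀ x y, B x y = B y x) :
    ∃ t : ℚ, t ≠ 0 ∧ (t, 0, 0) ∈ L ∧ ∃ w ∈ L, t * w.2.1 = 1 := by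
  obtain ⟨m, hm, hme⟩ := hL.full (1, 0, 0)
  obtain ⟨n, hn, hnf⟩ := hL.full (0, 1, 0)
  have hint : ∀ w ∈ L, ∃ k : ℤ, (m : ℚ) * w.2.1 = k := fun w hw => by
    simpa using hL.integral (hypForm_symm hB) hme hw
  let S : AddSubgroup ℤ :=
    (L.map (hypForm B (m • (1, 0, 0)) : (ℚ × ℚ × V) →+ ℚ)).comap (Int.castAddHom ℚ)
  have hS : ∀ k : ℤ, k ∈ S ↔ ∃ w ∈ L, (m : ℚ) * w.2.1 = k := fun k => by
    simp [S, AddSubgroup.mem_comap, AddSubgroup.mem_map]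
  obtain ⟨d, hd⟩ := Int.subgroup_cyclic S
  have key : ∀ k : ℤ, k ∈ S ↔ d ∣ k := fun k => by
    rw [hd, AddSubgroup.mem_closure_singleton]
    exact ⟨fun ⟨n, hn⟩ => ⟨n, by rw [← hn, smul_eq_mul, mul_comm]⟩,
      fun ⟨n, hn⟩ => ⟨n, by rw [hn, smul_eq_mul, mul_comm]⟩⟩
  have hmn : d ∣ m * n := (key _).1 ((hS _).2 ⟨_, hnf, by simp⟩)
  have hd0 : (d : ℚ) ≠ 0 := by
    intro h
    rw [Int.cast_eq_zero.1 h, zero_dvd_iff] at hmn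
    exact mul_ne_zero hm hn hmn
  have hm0 : (m : ℚ) ≠ 0 := by exact_mod_cast hm
  obtain ⟨w, hw, hwd⟩ := (hS d).1 ((key d).2 dvd_rfl)
  refine ⟨m / d, div_ne_zero hm0 hd0, hL.dual _ fun y hy => ?_, w, hw, ?_⟩
  · obtain ⟨k, hk⟩ := hint y hy
    obtain ⟨j, rfl⟩ := (key k).1 ((hS k).2 ⟨y, hy, hk⟩)
    refine ⟨j, ?_⟩
    push_cast at hk
    simp only [hypForm_apply, map_zero, LinearMap.zero_apply]
    field_simp
    linarith
  · field_simp
    linarith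

/-- A lattice containing the hyperbolic plane splits it off. -/
theorem IsEvenSelfDual.mem_iff_of_plane {L : AddSubgroup (ℚ × ℚ × V)}
    (hL : IsEvenSelfDual (hypForm B) L) (hB : ∀ x y, B x y = B y x)
    (he : (1, 0, 0) ∈ L) (hf : (0, 1, 0) ∈ L) (w : ℚ × ℚ × V) :
    w ∈ hypLattice (cuspLattice L) ↔ w ∈ L := by
  rw [mem_hypLattice]
  have hsmul : ∀ i j : ℤ, ((i : ℚ), (j : ℚ), (0 : V)) ∈ L := fun i j => by
    simpa using L.add_mem (L.zsmul_mem he i) (L.zsmul_mem hf j)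
  constructor
  · rintro ⟨⟨i, hi⟩, ⟨j, hj⟩, c, hc⟩
    obtain ⟨k, hk⟩ := hL.integral (hypForm_symm hB) hf hc
    have hck : c = k := by simpa using hk
    have := L.add_mem (hsmul (i - k) j) hc
    convert this using 1
    ext <;> simp [hi, hj, hck]
  · intro hw
    obtain ⟨i, hi⟩ := hL.integral (hypForm_symm hB) hf hw
    obtain ⟨j, hj⟩ := hL.integral (hypForm_symm hB) he hw
    simp only [hypForm_apply, map_zero, LinearMap.zero_apply] at hi hj
    refine ⟨⟨i, by linarith⟩, ⟨j, by linarith⟩, w.1, ?_⟩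
    have := L.sub_mem hw (hsmul 0 j)
    convert this using 1
    ext <;> simp
    linarith

theorem IsEvenSelfDual.of_hypLattice {N : AddSubgroup V}
    (h : IsEvenSelfDual (hypForm B) (hypLattice N)) : IsEvenSelfDual B N where
  even x hx := by
    simpa using h.even (0, 0, x) (mem_hypLattice.2 ⟨⟨0, by simp⟩, ⟨0, by simp⟩, hx⟩)
  dual x hx := by
    refine (mem_hypLattice.1 (h.dual (0, 0, x) fun y hy => ?_)).2.2
    simpa using hx y.2.2 (mem_hypLattice.1 hy).2.2
  full x := by
    obtain ⟨m, hm, hx⟩ := h.full (0, 0, x)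
    exact ⟨m, hm, by simpa using (mem_hypLattice.1 hx).2.2⟩

/-- An even self-dual lattice is equivalent to `U ⊕ N` with `N` its cusp lattice, and the
equivalence can be chosen to normalise a given vector of norm `-2` orthogonal to the cusp. -/
theorem IsEvenSelfDual.hypEquiv_cuspLattice {L : AddSubgroup (ℚ × ℚ × V)}
    (hL : IsEvenSelfDual (hypForm B) L) (hB : ∀ x y, B x y = B y x) {a : ℚ} {r : V}
    (har : (a, 0, r) ∈ L) (hrr : B r r = -2) :
    IsEvenSelfDual B (cuspLattice L) ∧
      HypEquiv B L (hypLattice (cuspLattice L)) (a, 0, r) (0, 0, r) := by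
  obtain ⟨t, ht, hte, ⟨α, β, z⟩, hw, htβ⟩ := hL.exists_dual_pair hB
  simp only at htβ
  obtain ⟨q, hq⟩ := hL.even _ hw
  simp only [hypForm_apply] at hq
  let g : (ℚ × ℚ × V) ≃ₗ[ℚ] (ℚ × ℚ × V) := (hypScale t ht).trans (eichler B (-z))
  have hg : ∀ x y, hypForm B (g x) (g y) = hypForm B x y := fun x y => by
    simp only [g, LinearEquiv.trans_apply, hypForm_eichler hB, hypForm_hypScale]
  have hgs : ∀ x y, hypForm B (g.symm x) (g.symm y) = hypForm B x y := fun x y => by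
    rw [← hg, g.apply_symm_apply, g.apply_symm_apply]
  obtain ⟨L₁, hL₁⟩ : ∃ L₁, L₁ = L.comap (g.symm : (ℚ × ℚ × V) →+ (ℚ × ℚ × V)) := ⟨_, rfl⟩
  have hmem : ∀ w, g w ∈ L₁ ↔ w ∈ L := fun w => by simp [hL₁]
  have hsd : IsEvenSelfDual (hypForm B) L₁ := hL₁ ▸ hL.comap g.symm hgs
  have hge : g (t, 0, 0) = (1, 0, 0) := by
    simp [g, hypScale_apply, eichler_apply, ht]
  have hgf : g ((α, β, z) - q • (t, 0, 0)) = (0, 1, 0) := by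
    have h1 : β = t⁻¹ := by field_simp; linarith
    subst h1
    simp only [g, LinearEquiv.trans_apply, hypScale_apply, eichler_apply, map_neg,
      LinearMap.neg_apply, Prod.fst_sub, Prod.snd_sub,
      Prod.smul_fst, Prod.smul_snd, zsmul_eq_mul, smul_zero, sub_zero,
      mul_inv_cancel₀ ht, one_smul, add_neg_cancel]
    refine Prod.ext ?_ rfl
    simp only
    field_simp
    field_simp at hq
    linarith
  have hplane := hsd.mem_iff_of_plane hB
    (hge ▸ (hmem _).2 hte) (hgf ▸ (hmem _).2 (L.sub_mem hw (L.zsmul_mem hte q)))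
  have hcoord : ∀ c y, g (c, 0, y) = (t⁻¹ * c + B z y, 0, y) := fun c y => by
    simp [g, hypScale_apply, eichler_apply]
  have hcusp : cuspLattice L₁ = cuspLattice L := by
    ext y
    simp only [mem_cuspLattice]
    constructor
    · rintro ⟨c, hc⟩
      refine ⟨t * (c - B z y), (hmem _).1 ?_⟩
      rw [hcoord]
      convert hc using 2
      field_simp
      ring
    · rintro ⟨c, hc⟩
      exact ⟨_, hcoord c y ▸ (hmem _).2 hc⟩
  have hN : IsEvenSelfDual B (cuspLattice L) := by
    rw [← hcusp]
    refine IsEvenSelfDual.of_hypLattice ?_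
    rwa [show hypLattice (cuspLattice L₁) = L₁ from AddSubgroup.ext hplane]
  refine ⟨hN, ?_⟩
  have hr : r ∈ cuspLattice L := ⟨a, har⟩
  have h₁ : HypEquiv B L (hypLattice (cuspLattice L)) (a, 0, r) (t⁻¹ * a + B z r, 0, r) :=
    ⟨g, hg, fun w => by rw [← hcusp, hplane, hmem], hcoord a r⟩
  obtain ⟨s, hs⟩ : ∃ s : ℤ, t⁻¹ * a + B z r = s := by
    obtain ⟨g', -, hg', hg''⟩ := h₁
    have := (hg' _).2 har
    rw [hg''] at this
    exact (mem_hypLattice.1 this).1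
  rw [hs] at h₁
  obtain ⟨y, hy, hyr⟩ := hN.exists_pairing_eq_one hB hr hrr
  refine h₁.trans ⟨eichler B (s • y), hypForm_eichler hB _, fun w => ?_, ?_⟩
  · obtain ⟨k, hk⟩ := hN.even _ ((cuspLattice L).zsmul_mem hy s)
    simp only [mem_hypLattice, eichler_apply, hk]
    constructor
    · rintro ⟨⟨i, hi⟩, ⟨j, hj⟩, h⟩
      have hw : w.2.2 ∈ cuspLattice L := by
        have := (cuspLattice L).sub_mem h ((cuspLattice L).zsmul_mem
          ((cuspLattice L).zsmul_mem hy s) j)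
        rwa [hj, Int.cast_smul_eq_zsmul, add_sub_cancel_right] at this
      obtain ⟨l, hl⟩ := hN.integral hB ((cuspLattice L).zsmul_mem hy s) hw
      refine ⟨⟨i + l + j * k, ?_⟩, ⟨j, hj⟩, hw⟩
      rw [hl, hj] at hi
      push_cast
      linarith
    · rintro ⟨⟨i, hi⟩, ⟨j, hj⟩, hw⟩
      obtain ⟨l, hl⟩ := hN.integral hB ((cuspLattice L).zsmul_mem hy s) hw
      refine ⟨⟨i - l - j * k, ?_⟩, ⟨j, hj⟩, ?_⟩
      · rw [hl, hi, hj]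
        push_cast
        ring
      · rw [hj, Int.cast_smul_eq_zsmul]
        exact (cuspLattice L).add_mem hw ((cuspLattice L).zsmul_mem
          ((cuspLattice L).zsmul_mem hy s) j)
  · simp [eichler_apply, hyr]

/-- The Eichler transvection fixing the second isotropic generator. -/
def eichlerOpp (B : V →ₗ[ℚ] V →ₗ[ℚ] ℚ) (x : V) : (ℚ × ℚ × V) ≃ₗ[ℚ] (ℚ × ℚ × V) :=
  hypSwap.trans ((eichler B x).trans hypSwap)

theorem eichlerOpp_apply (B : V →ₗ[ℚ] V →ₗ[ℚ] ℚ) (z : V) (w : ℚ × ℚ × V) :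
    eichlerOpp B z w = (w.1, w.2.1 - B z w.2.2 - w.1 * B z z / 2, w.2.2 + w.1 • z) := rfl

theorem eichlerOpp_symm_apply (B : V →ₗ[ℚ] V →ₗ[ℚ] ℚ) (z : V) (w : ℚ × ℚ × V) :
    (eichlerOpp B z).symm w = (w.1, w.2.1 + B z w.2.2 - w.1 * B z z / 2, w.2.2 - w.1 • z) := rfl

theorem hypForm_eichlerOpp (hB : ∀ x y, B x y = B y x) (z : V) (x y : ℚ × ℚ × V) :
    hypForm B (eichlerOpp B z x) (eichlerOpp B z y) = hypForm B x y := by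
  simp only [eichlerOpp, LinearEquiv.trans_apply, hypForm_hypSwap, hypForm_eichler hB]

/-- Over `ℚ`, a vector of norm `-2` can be moved into `e^⊥` over a prescribed `r`. -/
theorem exists_isometry_orthogonal (hB : ∀ x y, B x y = B y x) {r : V} (hrr : B r r = -2)
    {δ : ℚ × ℚ × V} (hδ : hypForm B δ δ = -2) :
    ∃ k : (ℚ × ℚ × V) ≃ₗ[ℚ] (ℚ × ℚ × V), (∀ x y, hypForm B (k x) (k y) = hypForm B x y) ∧
      ∃ a, k δ = (a, 0, r) := by
  have generic : ∀ η : ℚ × ℚ × V, hypForm B η η = -2 → η.1 ≠ 0 →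
      ∃ k : (ℚ × ℚ × V) ≃ₗ[ℚ] (ℚ × ℚ × V), (∀ x y, hypForm B (k x) (k y) = hypForm B x y) ∧
        ∃ a, k η = (a, 0, r) := by
    intro η hη h0
    have hv : (eichlerOpp B (η.1⁻¹ • (r - η.2.2)) η).2.2 = r := by
      simp [eichlerOpp_apply, h0]
    refine ⟨eichlerOpp B (η.1⁻¹ • (r - η.2.2)), hypForm_eichlerOpp hB _, η.1,
      Prod.ext rfl (Prod.ext ?_ hv)⟩
    have := hypForm_eichlerOpp hB (η.1⁻¹ • (r - η.2.2)) η η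
    rw [hη, hypForm_apply, hv, hrr] at this
    have h1 : (eichlerOpp B (η.1⁻¹ • (r - η.2.2)) η).1 = η.1 := rfl
    rw [h1] at this
    have h2 : η.1 * (eichlerOpp B (η.1⁻¹ • (r - η.2.2)) η).2.1 = 0 := by linarith
    exact (mul_eq_zero.1 h2).resolve_left h0
  suffices h : ∃ z, (eichler B z δ).1 ≠ 0 by
    obtain ⟨z, hz⟩ := h
    obtain ⟨k, hk, hkδ⟩ := generic _ ((hypForm_eichler hB z δ δ).trans hδ) hz
    exact ⟨(eichler B z).trans k,
      fun x y => by simp only [LinearEquiv.trans_apply, hk, hypForm_eichler hB], hkδ⟩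
  by_cases h0 : δ.1 = 0
  · have hv : B δ.2.2 δ.2.2 = -2 := by simpa [h0] using hδ
    by_cases h : δ.2.1 = -2
    · exact ⟨-δ.2.2, by simp [eichler_apply, h0, hv, h]; norm_num⟩
    · refine ⟨δ.2.2, fun h' => h ?_⟩
      simp only [eichler_apply, h0, hv] at h'
      linarith
  · exact ⟨0, by simpa [eichler_apply] using h0⟩

/-- Passing to a neighbour of `N` containing a prescribed vector `x` does not change `U ⊕ N`. -/
theorem IsEvenSelfDual.exists_neighbour {N : AddSubgroup V} (hN : IsEvenSelfDual B N)
    (hB : ∀ x y, B x y = B y x) {r : V} (hr : r ∈ N) (hrr : B r r = -2) {x : V}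
    (hx : ∃ k : ℤ, B x x = 2 * k) (hxr : ∃ k : ℤ, B x r = k) :
    ∃ N' : AddSubgroup V, IsEvenSelfDual B N' ∧ r ∈ N' ∧ x ∈ N' ∧
      (∀ y ∈ N, (∃ k : ℤ, B x y = k) → y ∈ N') ∧
      HypEquiv B (hypLattice N) (hypLattice N') (0, 0, r) (0, 0, r) := by
  obtain ⟨j, hj⟩ := hxr
  obtain ⟨z₁, hz₁, hz₁r⟩ := hN.exists_pairing_eq_one hB hr hrr
  obtain ⟨z, hz, hzr⟩ : ∃ z ∈ N, B z r = j :=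
    ⟨j • z₁, N.zsmul_mem hz₁ j, by simp [hz₁r]⟩
  have hr0 : (eichlerOpp B (x - z)).symm (0, 0, r) = (0, 0, r) := by
    simp [eichlerOpp_symm_apply, hj, hzr]
  have hiso := hypEquiv_comap_symm (eichlerOpp B (x - z)).symm (B := B) (fun u v => by
    rw [← hypForm_eichlerOpp hB (x - z), LinearEquiv.apply_symm_apply,
      LinearEquiv.apply_symm_apply]) (hypLattice N) (0, 0, r)
  rw [hr0] at hiso
  obtain ⟨L, hL⟩ : ∃ L, L = (hypLattice N).comap
      ((eichlerOpp B (x - z)).symm.symm : (ℚ × ℚ × V) →+ (ℚ × ℚ × V)) := ⟨_, rfl⟩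
  have hsd : IsEvenSelfDual (hypForm B) L :=
    hL ▸ hN.add_plane.comap (eichlerOpp B (x - z)) (hypForm_eichlerOpp hB _)
  have hmem : ∀ w, w ∈ L ↔ eichlerOpp B (x - z) w ∈ hypLattice N := fun w => by
    rw [hL]; rfl
  rw [← hL] at hiso
  have hcusp : ∀ y ∈ N, (∃ k : ℤ, B x y = k) → (0, 0, y) ∈ L := by
    rintro y hy ⟨k, hk⟩
    obtain ⟨l, hl⟩ := hN.integral hB hz hy
    rw [hmem, mem_hypLattice]
    refine ⟨⟨0, by simp [eichlerOpp_apply]⟩, ⟨l - k, ?_⟩, by simpa [eichlerOpp_apply] using hy⟩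
    simp [eichlerOpp_apply, hl, hk]
  have hrL := hcusp r hr ⟨j, hj⟩
  obtain ⟨hN', hequiv⟩ := hsd.hypEquiv_cuspLattice hB hrL hrr
  refine ⟨cuspLattice L, hN', ⟨0, hrL⟩, ⟨-1, ?_⟩, fun y hy hxy => ⟨0, hcusp y hy hxy⟩,
    hiso.trans hequiv⟩
  obtain ⟨k, hk⟩ := hx
  obtain ⟨l, hl⟩ := hN.even z hz
  rw [hmem, mem_hypLattice]
  refine ⟨⟨-1, by simp [eichlerOpp_apply]⟩, ⟨l - k, ?_⟩, by simpa [eichlerOpp_apply] using hz⟩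
  simp only [eichlerOpp_apply, map_sub, LinearMap.sub_apply, hk, hl, hB z x]
  push_cast
  ring

/-- In `U ⊕ N` every vector of norm `-2` is equivalent to any vector of norm `-2` in `N`. -/
theorem IsEvenSelfDual.hypEquiv_of_norm {N : AddSubgroup V} (hN : IsEvenSelfDual B N)
    (hB : ∀ x y, B x y = B y x) {s : Set V} (hs : s.Finite) (hsN : AddSubgroup.closure s = N)
    {r : V} (hr : r ∈ N) (hrr : B r r = -2) {δ : ℚ × ℚ × V} (hδN : δ ∈ hypLattice N)
    (hδ : hypForm B δ δ = -2) :
    HypEquiv B (hypLattice N) (hypLattice N) δ (0, 0, r) := by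
  have chain : ∀ t : Set V, t.Finite → t ⊆ N → ∃ N' : AddSubgroup V, IsEvenSelfDual B N' ∧
      r ∈ N' ∧ t ⊆ N' ∧ HypEquiv B (hypLattice N) (hypLattice N') δ (0, 0, r) := by
    intro t ht
    induction t, ht using Set.Finite.induction_on with
    | empty =>
      intro _
      obtain ⟨k, hk, a, hka⟩ := exists_isometry_orthogonal hB hrr hδ
      have hiso := hypEquiv_comap_symm k hk (hypLattice N) δ
      rw [hka] at hiso
      have hsd := hN.add_plane.comap k.symm (B := hypForm B) fun u v => by
        rw [← hk, k.apply_symm_apply, k.apply_symm_apply]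
      have har : (a, 0, r) ∈ (hypLattice N).comap (k.symm : (ℚ × ℚ × V) →+ (ℚ × ℚ × V)) := by
        simpa [← hka] using hδN
      obtain ⟨hN', hequiv⟩ := hsd.hypEquiv_cuspLattice hB har hrr
      exact ⟨_, hN', ⟨a, har⟩, Set.empty_subset _, hiso.trans hequiv⟩
    | @insert x t _ _ ih =>
      intro hxt
      obtain ⟨hxN, htN⟩ := Set.insert_subset_iff.1 hxt
      obtain ⟨N₁, hN₁, hr₁, ht₁, h₁⟩ := ih htN
      obtain ⟨N₂, hN₂, hr₂, hx₂, h₁₂, h₂⟩ := hN₁.exists_neighbour hB hr₁ hrr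
        (hN.even x hxN) (hN.integral hB hxN hr)
      exact ⟨N₂, hN₂, hr₂, Set.insert_subset hx₂ fun y hy =>
        h₁₂ y (ht₁ hy) (hN.integral hB hxN (htN hy)), h₁.trans h₂⟩
  obtain ⟨N', hN', -, hsN', h⟩ := chain s hs (hsN ▸ AddSubgroup.subset_closure)
  have hle : N ≤ N' := hsN ▸ (AddSubgroup.closure_le N').2 hsN'
  have heq : N' = N := le_antisymm
    (fun x hx => hN.dual x fun y hy => hN'.integral hB hx (hle hy)) hle
  rwa [heq] at h

end Hyperbolic

theorem gramL_eq_fromBlocks (a b : ℕ) :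
    Matrix.of (gramL a b) = Matrix.fromBlocks
      (Matrix.kronecker (1 : Matrix (Fin a) (Fin a) ℤ) !![0, 1; 1, 0]) 0 0
      (Matrix.kronecker (1 : Matrix (Fin b) (Fin b) ℤ) (-CartanMatrix.E₈)) := by
  ext i j
  rcases i with ⟨k, s⟩ | ⟨k, s⟩ <;> rcases j with ⟨k', s'⟩ | ⟨k', s'⟩
  · by_cases h : k = k'
    · fin_cases s <;> fin_cases s' <;> simp [gramL, h]
    · simp [gramL, h]
  · rfl
  · rfl
  · by_cases h : k = k' <;> simp [gramL, h]

theorem isUnit_det_gramL (a b : ℕ) : IsUnit (Matrix.of (gramL a b)).det := by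
  rw [gramL_eq_fromBlocks, Matrix.det_fromBlocks_zero₂₁]
  have h : (-CartanMatrix.E₈).det = 1 := by
    rw [Matrix.det_neg, CartanMatrix.E₈_det]
    decide
  simpa [Matrix.kronecker, Matrix.det_kronecker, h, Matrix.det_fin_two] using
    (isUnit_one (M := ℤ)).neg.pow a

theorem gramL_comm (a b : ℕ) (i j : LIdx a b) : gramL a b i j = gramL a b j i := by
  rcases i with ⟨k, s⟩ | ⟨k, s⟩ <;> rcases j with ⟨k', s'⟩ | ⟨k', s'⟩
  · simp [gramL, eq_comm]
  · rfl
  · rfl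
  · simp only [gramL, CartanMatrix.E₈_isSymm.apply s' s, @eq_comm _ k k']

theorem even_gramL_self (a b : ℕ) (i : LIdx a b) : Even (gramL a b i i) := by
  rcases i with ⟨k, s⟩ | ⟨k, s⟩ <;> simp [gramL]

theorem BLR_eq (a b : ℕ) (x y : LIdx a b → ℝ) :
    BLR a b x y = ∑ k, (x (.inl (k, 0)) * y (.inl (k, 1)) + x (.inl (k, 1)) * y (.inl (k, 0))) -
      ∑ k, ∑ s, ∑ s', x (.inr (k, s)) * (CartanMatrix.E₈ s s' : ℝ) * y (.inr (k, s')) := by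
  simp only [BLR, Fintype.sum_sum_type, Fintype.sum_prod_type, Fin.sum_univ_two]
  simp [gramL, Finset.sum_add_distrib, sub_eq_add_neg,
    Finset.sum_comm (s := Finset.univ (α := Fin b)) (t := Finset.univ (α := Fin 8))]

theorem BL_succ (a b : ℕ) (x y : LVec (a + 1) b) :
    BL (a + 1) b x y = x (.inl (0, 0)) * y (.inl (0, 1)) + x (.inl (0, 1)) * y (.inl (0, 0)) +
      BL a b (fun i => x (i.map (Prod.map Fin.succ id) id))
        (fun i => y (i.map (Prod.map Fin.succ id) id)) := by
  simp only [BL, Fintype.sum_sum_type, Fintype.sum_prod_type, Fin.sum_univ_two,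
    Fin.sum_univ_succ (n := a)]
  simp [gramL, (Fin.succ_ne_zero _).symm]
  ring

theorem E₈_nonneg (x : Fin 8 → ℝ) :
    0 ≤ ∑ s, ∑ s', x s * (CartanMatrix.E₈ s s' : ℝ) * x s' := by
  have h : ∑ s, ∑ s', x s * (CartanMatrix.E₈ s s' : ℝ) * x s' =
      2 * (x 0 - 1 / 2 * x 2) ^ 2 + 2 * (x 1 - 1 / 2 * x 3) ^ 2 +
      3 / 2 * (x 2 - 2 / 3 * x 3) ^ 2 + 5 / 6 * (x 3 - 6 / 5 * x 4) ^ 2 +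
      4 / 5 * (x 4 - 5 / 4 * x 5) ^ 2 + 3 / 4 * (x 5 - 4 / 3 * x 6) ^ 2 +
      2 / 3 * (x 6 - 3 / 2 * x 7) ^ 2 + 1 / 2 * x 7 ^ 2 := by
    simp [Fin.sum_univ_succ, CartanMatrix.E₈, Fin.succ]
    ring
  rw [h]
  positivity

/-- The rational extension of the form of `U^a ⊕ E₈(-1)^b`. -/
def ratForm (a b : ℕ) : (LIdx a b → ℚ) →ₗ[ℚ] (LIdx a b → ℚ) →ₗ[ℚ] ℚ :=
  Matrix.toLinearMap₂' ℚ ((Matrix.of (gramL a b)).map (Int.cast : ℤ → ℚ))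

theorem ratForm_apply (a b : ℕ) (x y : LIdx a b → ℚ) :
    ratForm a b x y = ∑ i, ∑ j, x i * (gramL a b i j : ℚ) * y j := by
  simp only [ratForm, Matrix.toLinearMap₂'_apply, Matrix.map_apply, Matrix.of_apply, smul_eq_mul]
  exact Finset.sum_congr rfl fun i _ => Finset.sum_congr rfl fun j _ => by ring

theorem ratForm_comm (a b : ℕ) (x y : LIdx a b → ℚ) : ratForm a b x y = ratForm a b y x := by
  rw [ratForm_apply, ratForm_apply, Finset.sum_comm]
  exact Finset.sum_congr rfl fun i _ => Finset.sum_congr rfl fun j _ => by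
    rw [gramL_comm a b i j]; ring

theorem ratForm_intCast (a b : ℕ) (x y : LVec a b) :
    ratForm a b (fun i => x i) (fun i => y i) = BL a b x y := by
  rw [ratForm_apply, BL]
  push_cast
  rfl

/-- The lattice of integral vectors in `ℚ^ι`. -/
def intLattice (ι : Type*) : AddSubgroup (ι → ℚ) :=
  ((Int.castAddHom ℚ).compLeft ι).range

theorem closure_single_eq_intLattice (ι : Type*) [Fintype ι] [DecidableEq ι] :
    AddSubgroup.closure (Set.range fun i : ι => Pi.single i (1 : ℚ)) = intLattice ι := by
  refine le_antisymm ((AddSubgroup.closure_le _).2 ?_) ?_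
  · rintro _ ⟨i, rfl⟩
    refine ⟨Pi.single i 1, ?_⟩
    ext j
    by_cases h : j = i
    · subst h; simp
    · simp [h]
  · rintro _ ⟨z, rfl⟩
    have : (Int.castAddHom ℚ).compLeft ι z = ∑ i, z i • Pi.single i (1 : ℚ) := by
      ext j
      simp [Finset.sum_apply, Pi.single_apply]
    rw [this]
    exact AddSubgroup.sum_mem _ fun i _ =>
      AddSubgroup.zsmul_mem _ (AddSubgroup.subset_closure (Set.mem_range_self i)) _

theorem even_BL_self (a b : ℕ) (x : LVec a b) : Even (BL a b x x) := by
  have hadd : ∀ u v : LVec a b, BL a b (u + v) (u + v) =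
      BL a b u u + BL a b v v + 2 * BL a b u v := fun u v => by
    have h := ratForm_comm a b (fun i => v i) (fun i => u i)
    have h' : BL a b v u = BL a b u v := by
      rw [ratForm_intCast, ratForm_intCast] at h
      exact_mod_cast h
    have : ∀ u v w : LVec a b, BL a b (u + v) w = BL a b u w + BL a b v w ∧
        BL a b w (u + v) = BL a b w u + BL a b w v := fun u v w => by
      simp only [BL, Pi.add_apply, add_mul, mul_add, Finset.sum_add_distrib, and_self]
    rw [(this _ _ _).1, (this _ _ _).2, (this _ _ _).2, h']
    ring
  rw [← Finset.univ_sum_single x]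
  refine Finset.sum_induction _ (fun u : LVec a b => Even (BL a b u u)) (fun u v hu hv => ?_)
    ?_ fun i _ => ?_
  · rw [hadd]
    exact (hu.add hv).add (even_two_mul _)
  · simp [BL]
  · have : BL a b (Pi.single i (x i)) (Pi.single i (x i)) = x i * gramL a b i i * x i := by
      rw [BL, Finset.sum_eq_single i, Finset.sum_eq_single i]
      · simp
      · intro j _ hj; simp [hj]
      · simp
      · intro j _ hj; simp [hj]
      · simp
    rw [this]
    exact ((even_gramL_self a b i).mul_left _).mul_right _

open scoped Matrix in
theorem isEvenSelfDual_intLattice (a b : ℕ) :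
    IsEvenSelfDual (ratForm a b) (intLattice (LIdx a b)) where
  even := by
    rintro _ ⟨z, rfl⟩
    obtain ⟨k, hk⟩ := even_BL_self a b z
    refine ⟨k, (ratForm_intCast a b z z).trans ?_⟩
    rw [hk]
    push_cast
    ring
  dual x hx := by
    have hcoord : ∀ i, ∃ k : ℤ, ((Matrix.of (gramL a b)).map (Int.cast : ℤ → ℚ) *ᵥ x) i = k := by
      intro i
      obtain ⟨k, hk⟩ := hx (Pi.single i 1)
        (closure_single_eq_intLattice (LIdx a b) ▸ AddSubgroup.subset_closure ⟨i, rfl⟩)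
      refine ⟨k, ?_⟩
      rw [← hk, ratForm_comm, ratForm, Matrix.toLinearMap₂'_apply', single_one_dotProduct]
    choose k hk using hcoord
    refine ⟨(Matrix.of (gramL a b))⁻¹ *ᵥ k, ?_⟩
    have hinv : (Matrix.of (gramL a b))⁻¹.map (Int.cast : ℤ → ℚ) *
        (Matrix.of (gramL a b)).map (Int.cast : ℤ → ℚ) = 1 := by
      have := congrArg (Int.castRingHom ℚ).mapMatrix
        (Matrix.nonsing_inv_mul _ (isUnit_det_gramL a b))
      rwa [map_mul, map_one] at this
    have hx' : x = (Matrix.of (gramL a b))⁻¹.map (Int.cast : ℤ → ℚ) *ᵥ (fun i => (k i : ℚ)) := by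
      rw [← funext hk, Matrix.mulVec_mulVec, hinv, Matrix.one_mulVec]
    rw [hx']
    ext i
    simp [Matrix.mulVec, dotProduct]
  full x := by
    refine ⟨∏ i, ((x i).den : ℤ), Finset.prod_ne_zero_iff.2 fun i _ => by simp,
      fun i => (∏ j ∈ Finset.univ.erase i, ((x j).den : ℤ)) * (x i).num, ?_⟩
    ext i
    have := Rat.mul_den_eq_num (x i)
    simp only [AddMonoidHom.compLeft_apply, Function.comp_apply, Int.coe_castAddHom,
      Pi.smul_apply, zsmul_eq_mul]
    rw [← Finset.prod_erase_mul _ _ (Finset.mem_univ i)]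
    push_cast
    rw [← this]
    ring

/-- Splitting off the first hyperbolic plane, with rational coefficients. -/
def splitPlane (a b : ℕ) : LVec (a + 1) b →+ ℚ × ℚ × (LIdx a b → ℚ) where
  toFun x := (x (.inl (0, 0)), x (.inl (0, 1)), fun i => x (i.map (Prod.map Fin.succ id) id))
  map_zero' := by ext <;> simp
  map_add' x y := by ext <;> simp

theorem splitPlane_apply (a b : ℕ) (x : LVec (a + 1) b) :
    splitPlane a b x =
      ((x (.inl (0, 0)) : ℚ), (x (.inl (0, 1)) : ℚ),
        fun i => (x (i.map (Prod.map Fin.succ id) id) : ℚ)) := rfl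

theorem splitPlane_injective (a b : ℕ) : Function.Injective (splitPlane a b) := by
  intro x y h
  simp only [splitPlane_apply, Prod.mk.injEq, Int.cast_inj, funext_iff] at h
  obtain ⟨h0, h1, h2⟩ := h
  ext i
  rcases i with ⟨k, s⟩ | ⟨k, s⟩
  · refine Fin.cases ?_ (fun k => h2 (.inl (k, s))) k
    fin_cases s
    exacts [h0, h1]
  · exact h2 (.inr (k, s))

theorem exists_splitPlane_eq (a b : ℕ) (p q : ℤ) (v : LVec a b) :
    ∃ x, splitPlane a b x = ((p : ℚ), (q : ℚ), fun i => (v i : ℚ)) := by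
  refine ⟨Sum.elim (fun i => Fin.cases (![p, q] i.2) (fun k => v (.inl (k, i.2))) i.1)
    (fun i => v (.inr i)), ?_⟩
  rw [splitPlane_apply]
  refine Prod.ext rfl (Prod.ext rfl (funext fun i => ?_))
  rcases i with ⟨k, s⟩ | ⟨k, s⟩ <;> rfl

theorem mem_hypLattice_iff_splitPlane (a b : ℕ) (w : ℚ × ℚ × (LIdx a b → ℚ)) :
    w ∈ hypLattice (intLattice (LIdx a b)) ↔ ∃ x, splitPlane a b x = w := by
  rw [mem_hypLattice]
  constructor
  · rintro ⟨⟨p, hp⟩, ⟨q, hq⟩, v, hv⟩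
    obtain ⟨x, hx⟩ := exists_splitPlane_eq a b p q v
    exact ⟨x, hx.trans (Prod.ext hp.symm (Prod.ext hq.symm hv))⟩
  · rintro ⟨x, rfl⟩
    exact ⟨⟨_, rfl⟩, ⟨_, rfl⟩, _, rfl⟩

theorem hypForm_splitPlane (a b : ℕ) (x y : LVec (a + 1) b) :
    hypForm (ratForm a b) (splitPlane a b x) (splitPlane a b y) = BL (a + 1) b x y := by
  rw [BL_succ, hypForm_apply]
  simp only [splitPlane_apply]
  rw [ratForm_intCast a b (fun i => x (i.map (Prod.map Fin.succ id) id))]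
  push_cast
  rfl

/-- Additive automorphisms of a subgroup lift along an injection. -/
theorem exists_linearEquiv_of_preserves {A W : Type*} [AddCommGroup A] [AddCommGroup W]
    (j : A →+ W) (hj : Function.Injective j) (g : W ≃+ W)
    (hg : ∀ w, (∃ x, j x = g w) ↔ ∃ x, j x = w) :
    ∃ σ : A ≃ₗ[ℤ] A, ∀ x, j (σ x) = g (j x) := by
  choose σ hσ using fun x => (hg (j x)).2 ⟨x, rfl⟩
  choose τ hτ using fun x => (hg (g.symm (j x))).1 ⟨x, by simp⟩
  refine ⟨AddEquiv.toIntLinearEquiv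
    { toFun := σ, invFun := τ, left_inv := fun x => hj ?_, right_inv := fun x => hj ?_,
      map_add' := fun x y => hj ?_ }, hσ⟩
  · rw [hτ, hσ, g.symm_apply_apply]
  · rw [hσ, hτ, g.apply_symm_apply]
  · simp only [map_add, hσ]

/-- Given a norm `-2` vector orthogonal to the first plane, all others are isometric to it. -/
theorem exists_isometry_to_root (a b : ℕ) (v : LVec a b) (hv : BL a b v v = -2) :
    ∃ r : LVec (a + 1) b, r (.inl (0, 0)) = -r (.inl (0, 1)) ∧
      ∀ δ, BL (a + 1) b δ δ = -2 → ∃ σ : LVec (a + 1) b ≃ₗ[ℤ] LVec (a + 1) b,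
        (∀ x y, BL (a + 1) b (σ x) (σ y) = BL (a + 1) b x y) ∧ σ δ = r := by
  obtain ⟨r, hr⟩ := exists_splitPlane_eq a b 0 0 v
  refine ⟨r, ?_, fun δ hδ => ?_⟩
  · rw [splitPlane_apply, Prod.mk.injEq, Prod.mk.injEq] at hr
    rw [Int.cast_inj.1 hr.1, Int.cast_inj.1 hr.2.1, neg_zero]
  obtain ⟨g, hg, hgL, hgδ⟩ := (isEvenSelfDual_intLattice a b).hypEquiv_of_norm (ratForm_comm a b)
    (Set.finite_range _) (closure_single_eq_intLattice _) (r := fun i => (v i : ℚ)) ⟨v, rfl⟩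
    (by rw [ratForm_intCast, hv]; norm_num)
    ((mem_hypLattice_iff_splitPlane a b _).2 ⟨δ, rfl⟩) (by rw [hypForm_splitPlane, hδ]; norm_num)
  obtain ⟨σ, hσ⟩ := exists_linearEquiv_of_preserves (splitPlane a b) (splitPlane_injective a b)
    g.toAddEquiv fun w => by
      have := hgL w
      rwa [mem_hypLattice_iff_splitPlane, mem_hypLattice_iff_splitPlane] at this
  refine ⟨σ, fun x y => ?_, splitPlane_injective a b ?_⟩
  · have : (BL (a + 1) b (σ x) (σ y) : ℚ) = BL (a + 1) b x y := by
      rw [← hypForm_splitPlane, ← hypForm_splitPlane, hσ, hσ]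
      exact hg _ _
    exact_mod_cast this
  · rw [hσ, hr]
    simpa using hgδ

theorem exists_reference_root (a b : ℕ) :
    ∃ r : LVec (a + 1) b, r (.inl (0, 0)) = -r (.inl (0, 1)) ∧
      ∀ δ, BL (a + 1) b δ δ = -2 → ∃ σ : LVec (a + 1) b ≃ₗ[ℤ] LVec (a + 1) b,
        (∀ x y, BL (a + 1) b (σ x) (σ y) = BL (a + 1) b x y) ∧ σ δ = r := by
  rcases a with _ | a
  · rcases b with _ | b
    · refine ⟨fun i => Sum.elim (fun p => ![1, -1] p.2) 0 i, by simp, fun δ hδ => ?_⟩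
      have hB : ∀ x y : LVec (0 + 1) 0, BL (0 + 1) 0 x y =
          x (.inl (0, 0)) * y (.inl (0, 1)) + x (.inl (0, 1)) * y (.inl (0, 0)) := fun x y => by
        rw [BL_succ]
        simp [BL]
      have hext : ∀ x y : LVec (0 + 1) 0, x (.inl (0, 0)) = y (.inl (0, 0)) →
          x (.inl (0, 1)) = y (.inl (0, 1)) → x = y := fun x y h0 h1 => by
        ext i
        rcases i with ⟨k, s⟩ | ⟨k, s⟩
        · obtain rfl : k = 0 := by omega
          fin_cases s
          exacts [h0, h1]
        · exact k.elim0
      rw [hB] at hδ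
      have hmul : δ (.inl (0, 0)) * -δ (.inl (0, 1)) = 1 := by linarith
      rcases Int.mul_eq_one_iff_eq_one_or_neg_one.1 hmul with ⟨h0, h1⟩ | ⟨h0, h1⟩
      · exact ⟨LinearEquiv.refl ℤ _, fun _ _ => rfl, hext _ _ (by simpa using h0)
          (by simpa using (by linarith : δ (.inl (0, 1)) = -1))⟩
      · exact ⟨LinearEquiv.neg ℤ, fun x y => by simp [hB],
          hext _ _ (by simpa using (by linarith : -δ (.inl (0, 0)) = 1)) (by simpa using h1)⟩
    · refine exists_isometry_to_root 0 (b + 1) (Pi.single (.inr (0, 0)) 1) ?_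
      rw [BL, Finset.sum_eq_single (.inr (0, 0)), Finset.sum_eq_single (.inr (0, 0))]
      · simp [gramL]
      · intro j _ hj; simp [hj]
      · simp
      · intro j _ hj; simp [hj]
      · simp
  · refine exists_isometry_to_root (a + 1) b
      (Pi.single (.inl (0, 0)) 1 - Pi.single (.inl (0, 1)) 1) ?_
    rw [BL_succ]
    simp [BL, Pi.single_apply, Sum.map, Prod.ext_iff, Fin.succ_ne_zero]

/-- A criterion for `PresOrient` in terms of a parametrised positive subspace. -/
theorem presOrient_of_frame (a b : ℕ) (φ : LVec a b ≃ₗ[ℤ] LVec a b)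
    (f : (Fin a → ℝ) →ₗ[ℝ] (LIdx a b → ℝ)) (p : (LIdx a b → ℝ) →ₗ[ℝ] (Fin a → ℝ))
    (hpf : ∀ c, p (f c) = c) (hpos : ∀ c, c ≠ 0 → 0 < BLR a b (f c) (f c))
    (horth : ∀ v c, BLR a b (v - f (p v)) (f c) = 0)
    (hdet : 0 < LinearMap.det (p ∘ₗ realExt φ ∘ₗ f)) : PresOrient a b φ := by
  have hinj : Function.Injective f := Function.LeftInverse.injective hpf
  let e := LinearEquiv.ofInjective f hinj
  have he : ∀ c, (e c : LIdx a b → ℝ) = f c := fun c => LinearEquiv.ofInjective_apply f c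
  refine ⟨LinearMap.range f, ?_, ?_, e.toLinearMap ∘ₗ p, ?_, ?_, ?_⟩
  · rw [LinearMap.finrank_range_of_inj hinj, Module.finrank_fin_fun]
  · rintro _ ⟨c, rfl⟩ hc
    exact hpos c fun h => hc (by rw [h, map_zero])
  · rintro ⟨_, c, rfl⟩
    refine Subtype.ext ?_
    simp [he, hpf]
  · rintro v _ ⟨c, rfl⟩
    simpa [he] using horth v c
  · rw [← LinearMap.det_conj _ e] at hdet
    convert hdet using 2
    ext ⟨_, c, rfl⟩ i
    have : e.symm ⟨f c, c, rfl⟩ = c := e.symm_apply_eq.2 (Subtype.ext (he c).symm)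
    simp [this]

theorem realExt_intCast {ι : Type} [Fintype ι] [DecidableEq ι]
    (φ : (ι → ℤ) ≃ₗ[ℤ] (ι → ℤ)) (x : ι → ℤ) :
    realExt φ (fun i => (x i : ℝ)) = fun i => (φ x i : ℝ) := by
  have h : φ x = Matrix.mulVec (LinearMap.toMatrix' (φ : (ι → ℤ) →ₗ[ℤ] (ι → ℤ))) x := by
    rw [LinearMap.toMatrix'_mulVec]
    rfl
  rw [h]
  ext i
  simp [realExt, Matrix.toLin'_apply, Matrix.mulVec, dotProduct]

theorem realExt_eq_of_intCast {ι : Type} [Fintype ι] [DecidableEq ι]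
    (φ : (ι → ℤ) ≃ₗ[ℤ] (ι → ℤ)) (f : (ι → ℝ) →ₗ[ℝ] (ι → ℝ))
    (hf : ∀ x : ι → ℤ, f (fun i => (x i : ℝ)) = fun i => (φ x i : ℝ)) : realExt φ = f := by
  refine (Pi.basisFun ℝ ι).ext fun i => ?_
  have : (Pi.basisFun ℝ ι i : ι → ℝ) = fun j => ((Pi.single i 1 : ι → ℤ) j : ℝ) := by
    ext j
    by_cases h : j = i
    · subst h; simp
    · simp [h]
  rw [this, realExt_intCast, hf]

theorem realExt_trans {ι : Type} [Fintype ι] [DecidableEq ι]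
    (φ ψ : (ι → ℤ) ≃ₗ[ℤ] (ι → ℤ)) : realExt (φ.trans ψ) = realExt ψ ∘ₗ realExt φ :=
  realExt_eq_of_intCast _ _ fun x => by
    rw [LinearMap.comp_apply, realExt_intCast, realExt_intCast]
    rfl

theorem realExt_refl {ι : Type} [Fintype ι] [DecidableEq ι] :
    realExt (LinearEquiv.refl ℤ (ι → ℤ)) = LinearMap.id :=
  realExt_eq_of_intCast _ _ fun _ => rfl

theorem realExt_symm_realExt {ι : Type} [Fintype ι] [DecidableEq ι]
    (φ : (ι → ℤ) ≃ₗ[ℤ] (ι → ℤ)) (v : ι → ℝ) : realExt φ.symm (realExt φ v) = v := by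
  rw [← LinearMap.comp_apply, ← realExt_trans, LinearEquiv.self_trans_symm, realExt_refl]
  rfl

theorem BLR_realExt (a b : ℕ) (φ : LVec a b ≃ₗ[ℤ] LVec a b)
    (hφ : ∀ x y, BL a b (φ x) (φ y) = BL a b x y) (v w : LIdx a b → ℝ) :
    BLR a b (realExt φ v) (realExt φ w) = BLR a b v w := by
  let B : (LIdx a b → ℝ) →ₗ[ℝ] (LIdx a b → ℝ) →ₗ[ℝ] ℝ :=
    Matrix.toLinearMap₂' ℝ ((Matrix.of (gramL a b)).map (Int.cast : ℤ → ℝ))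
  have hB : ∀ v w, B v w = BLR a b v w := fun v w => by
    simp only [B, BLR, Matrix.toLinearMap₂'_apply, Matrix.map_apply, Matrix.of_apply, smul_eq_mul]
    exact Finset.sum_congr rfl fun i _ => Finset.sum_congr rfl fun j _ => by ring
  have hcast : ∀ x y : LVec a b, B (fun i => x i) (fun i => y i) = BL a b x y := fun x y => by
    rw [hB, BLR, BL]
    push_cast
    rfl
  have hsingle : ∀ i, (Pi.basisFun ℝ (LIdx a b) i : LIdx a b → ℝ) =
      fun j => ((Pi.single i 1 : LVec a b) j : ℝ) := fun i => by
    ext j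
    by_cases h : j = i
    · subst h; simp
    · simp [h]
  have key : B.compl₁₂ (realExt φ) (realExt φ) = B := by
    refine LinearMap.ext_basis (Pi.basisFun ℝ _) (Pi.basisFun ℝ _) fun i j => ?_
    rw [LinearMap.compl₁₂_apply, hsingle, hsingle, realExt_intCast, realExt_intCast, hcast, hcast,
      hφ]
  rw [← hB, ← hB]
  exact LinearMap.congr_fun₂ key v w

/-- The standard parametrised maximal positive subspace. -/
def posFrame (a b : ℕ) : (Fin a → ℝ) →ₗ[ℝ] (LIdx a b → ℝ) where
  toFun c := Sum.elim (fun i => c i.1) 0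
  map_add' c d := by ext (i | i) <;> simp
  map_smul' t c := by ext (i | i) <;> simp

/-- The orthogonal projection onto the standard positive subspace, in its coordinates. -/
def posProj (a b : ℕ) : (LIdx a b → ℝ) →ₗ[ℝ] (Fin a → ℝ) where
  toFun v k := (v (.inl (k, 0)) + v (.inl (k, 1))) / 2
  map_add' v w := by ext k; simp; ring
  map_smul' t v := by ext k; simp; ring

theorem posProj_posFrame (a b : ℕ) (c : Fin a → ℝ) : posProj a b (posFrame a b c) = c := by
  ext k; simp [posProj, posFrame]

theorem BLR_posFrame_pos (a b : ℕ) (c : Fin a → ℝ) (hc : c ≠ 0) :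
    0 < BLR a b (posFrame a b c) (posFrame a b c) := by
  rw [BLR_eq]
  simp only [posFrame, LinearMap.coe_mk, AddHom.coe_mk, Sum.elim_inl, Sum.elim_inr, Pi.zero_apply,
    zero_mul, Finset.sum_const_zero, sub_zero]
  obtain ⟨k, hk⟩ := Function.ne_iff.1 hc
  refine Finset.sum_pos' (fun i _ => by nlinarith [mul_self_nonneg (c i)])
    ⟨k, Finset.mem_univ k, ?_⟩
  have := mul_self_pos.2 hk
  linarith

theorem BLR_sub_posProj (a b : ℕ) (v : LIdx a b → ℝ) (c : Fin a → ℝ) :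
    BLR a b (v - posFrame a b (posProj a b v)) (posFrame a b c) = 0 := by
  rw [BLR_eq]
  simp only [posFrame, posProj, LinearMap.coe_mk, AddHom.coe_mk, Sum.elim_inl, Sum.elim_inr,
    Pi.zero_apply, Pi.sub_apply, mul_zero, Finset.sum_const_zero, sub_zero]
  exact Finset.sum_eq_zero fun k _ => by ring

theorem BLR_nonpos_of_posProj (a b : ℕ) (v : LIdx a b → ℝ) (hv : posProj a b v = 0) :
    BLR a b v v ≤ 0 := by
  rw [BLR_eq]
  have h1 : ∑ k, (v (.inl (k, 0)) * v (.inl (k, 1)) + v (.inl (k, 1)) * v (.inl (k, 0))) ≤ 0 := by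
    refine Finset.sum_nonpos fun k _ => ?_
    have hk : (v (.inl (k, 0)) + v (.inl (k, 1))) / 2 = 0 := congrFun hv k
    have hk' : v (.inl (k, 1)) = -v (.inl (k, 0)) := by linarith
    rw [hk']
    nlinarith [mul_self_nonneg (v (.inl (k, 0)))]
  have h2 := Finset.sum_nonneg fun k (_ : k ∈ Finset.univ) =>
    E₈_nonneg fun s => v (.inr (k, s))
  linarith

theorem det_posProj_ne_zero (a b : ℕ) (φ : LVec a b ≃ₗ[ℤ] LVec a b)
    (hφ : ∀ x y, BL a b (φ x) (φ y) = BL a b x y) :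
    LinearMap.det (posProj a b ∘ₗ realExt φ ∘ₗ posFrame a b) ≠ 0 := by
  have hinj : Function.Injective (posProj a b ∘ₗ realExt φ ∘ₗ posFrame a b) := by
    refine (injective_iff_map_eq_zero _).2 fun c hc => by_contra fun h0 => ?_
    have h1 : BLR a b (realExt φ (posFrame a b c)) (realExt φ (posFrame a b c)) ≤ 0 :=
      BLR_nonpos_of_posProj a b _ hc
    rw [BLR_realExt a b φ hφ] at h1
    exact absurd (BLR_posFrame_pos a b c h0) (not_lt.2 h1)
  exact (LinearEquiv.isUnit_det' (LinearEquiv.ofInjectiveEndo _ hinj)).ne_zero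

/-- The isometry `(x, y) ↦ (-y, -x)` of the first hyperbolic plane, extended by the identity. -/
def negSwap (a b : ℕ) (R : Type*) [CommRing R] :
    (LIdx (a + 1) b → R) ≃ₗ[R] (LIdx (a + 1) b → R) :=
  LinearEquiv.ofInvolutive
    { toFun := fun x => Sum.elim
        (fun i => Fin.cases (-x (.inl (0, i.2.rev))) (fun k => x (.inl (k.succ, i.2))) i.1)
        (fun i => x (.inr i))
      map_add' := fun x y => by
        ext (⟨k, s⟩ | i)
        · refine Fin.cases ?_ (fun k => ?_) k <;> simp [add_comm]
        · simp
      map_smul' := fun t x => by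
        ext (⟨k, s⟩ | i)
        · refine Fin.cases ?_ (fun k => ?_) k <;> simp
        · simp }
    fun x => by
      ext (⟨k, s⟩ | i)
      · refine Fin.cases ?_ (fun k => ?_) k <;> simp
      · simp

theorem negSwap_apply (a b : ℕ) (R : Type*) [CommRing R] (x : LIdx (a + 1) b → R) :
    negSwap a b R x = Sum.elim
      (fun i => Fin.cases (-x (.inl (0, i.2.rev))) (fun k => x (.inl (k.succ, i.2))) i.1)
      (fun i => x (.inr i)) := rfl

theorem BL_negSwap (a b : ℕ) (x y : LVec (a + 1) b) :
    BL (a + 1) b (negSwap a b ℤ x) (negSwap a b ℤ y) = BL (a + 1) b x y := by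
  have h : ∀ (x : LVec (a + 1) b) (i : LIdx a b),
      negSwap a b ℤ x (i.map (Prod.map Fin.succ id) id) =
        x (i.map (Prod.map Fin.succ id) id) := by
    rintro x (⟨k, s⟩ | i) <;> rfl
  have h0 : ∀ x : LVec (a + 1) b, negSwap a b ℤ x (.inl (0, 0)) = -x (.inl (0, 1)) := fun _ => rfl
  have h1 : ∀ x : LVec (a + 1) b, negSwap a b ℤ x (.inl (0, 1)) = -x (.inl (0, 0)) := fun _ => rfl
  rw [BL_succ, BL_succ a b x y]
  simp only [h, h0, h1]
  ring

theorem negSwap_eq_self (a b : ℕ) (r : LVec (a + 1) b)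
    (hr : r (.inl (0, 0)) = -r (.inl (0, 1))) : negSwap a b ℤ r = r := by
  ext (⟨k, s⟩ | i)
  · refine Fin.cases ?_ (fun k => rfl) k
    fin_cases s
    · exact hr.symm
    · exact (neg_eq_iff_eq_neg.2 hr : -r (.inl (0, 0)) = r (.inl (0, 1)))
  · rfl

theorem realExt_negSwap_posFrame (a b : ℕ) (c : Fin (a + 1) → ℝ) :
    realExt (negSwap a b ℤ) (posFrame (a + 1) b c) =
      posFrame (a + 1) b (Matrix.toLin' (Matrix.diagonal (Fin.cons (-1) 1)) c) := by
  rw [realExt_eq_of_intCast (negSwap a b ℤ) (negSwap a b ℝ).toLinearMap fun x => ?_]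
  · ext (⟨k, s⟩ | i)
    · refine Fin.cases ?_ (fun k => ?_) k <;>
        simp [negSwap_apply, posFrame, Matrix.mulVec_diagonal]
    · rfl
  · ext (⟨k, s⟩ | i)
    · refine Fin.cases ?_ (fun k => ?_) k <;> simp [negSwap_apply]
    · simp [negSwap_apply]

/-- `O⁺(U^a ⊕ E₈(-1)^b)` acts transitively on the set of norm `-2` vectors. -/
theorem statement6 (a b : ℕ) (ha : 1 ≤ a) (δ δ' : LVec a b)
    (hδ : BL a b δ δ = -2) (hδ' : BL a b δ' δ' = -2) :
    ∃ σ : LVec a b ≃ₗ[ℤ] LVec a b,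
      (∀ x y, BL a b (σ x) (σ y) = BL a b x y) ∧ PresOrient a b σ ∧ σ δ = δ' := by
  obtain ⟨a, rfl⟩ : ∃ a', a = a' + 1 := ⟨a - 1, by omega⟩
  obtain ⟨r, hr, hroot⟩ := exists_reference_root a b
  obtain ⟨g, hg, hgδ⟩ := hroot δ hδ
  obtain ⟨h, hh, hhδ⟩ := hroot δ' hδ'
  have hhs : ∀ x y, BL (a + 1) b (h.symm x) (h.symm y) = BL (a + 1) b x y := fun x y => by
    rw [← hh, h.apply_symm_apply, h.apply_symm_apply]
  have hgs : ∀ x y, BL (a + 1) b (g.symm x) (g.symm y) = BL (a + 1) b x y := fun x y => by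
    rw [← hg, g.apply_symm_apply, g.apply_symm_apply]
  have hgg : ∀ v, realExt g (realExt g.symm v) = v := fun v => realExt_symm_realExt g.symm v
  have orient : ∀ σ : LVec (a + 1) b ≃ₗ[ℤ] LVec (a + 1) b,
      0 < LinearMap.det (posProj (a + 1) b ∘ₗ realExt ((g.symm.trans σ).trans g) ∘ₗ
        posFrame (a + 1) b) → PresOrient (a + 1) b σ := fun σ hσ => by
    refine presOrient_of_frame _ _ _ (realExt g.symm ∘ₗ posFrame (a + 1) b)
      (posProj (a + 1) b ∘ₗ realExt g) (fun c => ?_) (fun c hc => ?_) (fun v c => ?_) ?_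
    · simp only [LinearMap.comp_apply, hgg, posProj_posFrame]
    · simpa only [LinearMap.comp_apply, BLR_realExt _ _ _ hgs] using BLR_posFrame_pos _ _ c hc
    · rw [← BLR_realExt _ _ _ hg]
      simpa only [LinearMap.comp_apply, map_sub, hgg] using BLR_sub_posProj _ _ (realExt g v) c
    · simpa only [realExt_trans, LinearMap.comp_assoc] using hσ
  have hdet := det_posProj_ne_zero (a + 1) b (h.symm.trans g) fun x y => by
    simp only [LinearEquiv.trans_apply, hg, hhs]
  rcases hdet.lt_or_gt with hneg | hpos
  · refine ⟨(g.trans (negSwap a b ℤ)).trans h.symm, fun x y => ?_, orient _ ?_, ?_⟩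
    · simp only [LinearEquiv.trans_apply, hhs, BL_negSwap, hg]
    · have hfactor : posProj (a + 1) b ∘ₗ
          realExt ((g.symm.trans ((g.trans (negSwap a b ℤ)).trans h.symm)).trans g) ∘ₗ
            posFrame (a + 1) b =
          (posProj (a + 1) b ∘ₗ realExt (h.symm.trans g) ∘ₗ posFrame (a + 1) b) ∘ₗ
            Matrix.toLin' (Matrix.diagonal (Fin.cons (-1) 1)) := by
        refine LinearMap.ext fun c => ?_
        simp only [realExt_trans, LinearMap.comp_apply, hgg, realExt_negSwap_posFrame]
      have hdiag : LinearMap.det (Matrix.toLin' (Matrix.diagonal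
          (Fin.cons (-1) 1 : Fin (a + 1) → ℝ))) = -1 := by
        simp [LinearMap.det_toLin', Matrix.det_diagonal, Fin.prod_univ_succ]
      rw [hfactor, LinearMap.det_comp, hdiag]
      linarith
    · rw [LinearEquiv.trans_apply, LinearEquiv.trans_apply, hgδ, negSwap_eq_self a b r hr,
        ← hhδ, h.symm_apply_apply]
  · refine ⟨g.trans h.symm, fun x y => ?_, orient _ ?_, ?_⟩
    · simp only [LinearEquiv.trans_apply, hhs, hg]
    · rwa [← LinearEquiv.trans_assoc, LinearEquiv.symm_trans_self, LinearEquiv.refl_trans]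
    · simp only [LinearEquiv.trans_apply, hgδ, ← hhδ, h.symm_apply_apply]
end
end

section
/- For real numbers a, b, x with a not an integer, there exist integers m and n such that |2(a − m)(b − n) − x| < 1. -/
/-- For real numbers `a, b, x` with `a` not an integer, there exist integers `m, n` with
`|2(a-m)(b-n) - x| < 1`. -/
theorem statement8 (a b x : ℝ) (ha : ¬ ∃ m : ℤ, a = m) :
    ∃ m n : ℤ, |2 * (a - m) * (b - n) - x| < 1 := by
  have hpos : 0 < a - ⌊a⌋ :=
    sub_pos.mpr (lt_of_le_of_ne (Int.floor_le a) fun h => ha ⟨_, h.symm⟩)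
  have hlt : a - ⌊a⌋ < 1 := by linarith [Int.lt_floor_add_one a]
  refine ⟨⌊a⌋, round (b - x / (2 * (a - ⌊a⌋))), ?_⟩
  have hround := abs_sub_round (b - x / (2 * (a - ⌊a⌋)))
  generalize round (b - x / (2 * (a - ⌊a⌋))) = n at hround ⊢
  generalize a - (⌊a⌋ : ℝ) = f at *
  have hfactor : 2 * f * (b - n) - x = 2 * f * (b - x / (2 * f) - n) := by
    field_simp
    ring
  rw [hfactor, abs_mul, abs_of_pos (by positivity : 0 < 2 * f)]
  nlinarith
end

section
/- Let W = ℝ²² with a symmetric bilinear form of signature (3,19), and let V = W ⊕ ℝf ⊕ ℝe with ⟨f,f⟩ = ⟨e,e⟩ = 0, ⟨f,e⟩ = 1, and f, e orthogonal to W (so V has signature (4,20)). Extend the form ℂ-bilinearly to V ⊗ ℂ. Suppose E ⊂ W is a 2-dimensional subspace on which the form is positive definite, and Ω ∈ V ⊗ ℂ satisfies ⟨Ω,Ω⟩ = 0, ⟨Ω, Ω̄⟩ > 0, and ⟨Ω, u⟩ = 0 for every u ∈ E. Then ⟨Ω, f⟩ ≠ 0 and ⟨Ω, e⟩ ≠ 0.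 -/
noncomputable section

open scoped BigOperators ComplexOrder

/-- The symmetric bilinear form of signature `(3,19)` on `W = ℝ²² = (Fin 3 ⊕ Fin 19) → ℝ`. -/
def B319 (x y : (Fin 3 ⊕ Fin 19) → ℝ) : ℝ :=
  (∑ i : Fin 3, x (Sum.inl i) * y (Sum.inl i)) - ∑ j : Fin 19, x (Sum.inr j) * y (Sum.inr j)

/-- The ℂ-bilinear extension of the signature `(3,19)` form to `W ⊗ ℂ`. -/
def B319C (x y : (Fin 3 ⊕ Fin 19) → ℂ) : ℂ :=
  (∑ i : Fin 3, x (Sum.inl i) * y (Sum.inl i)) - ∑ j : Fin 19, x (Sum.inr j) * y (Sum.inr j)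

/-- The ℂ-bilinear extension to `V ⊗ ℂ` of the signature `(4,20)` form on
`V = W ⊕ ℝf ⊕ ℝe`: `⟨(w,a,b),(w',a',b')⟩ = ⟨w,w'⟩ + a b' + a' b`. -/
def B420C (u v : ((Fin 3 ⊕ Fin 19) → ℂ) × ℂ × ℂ) : ℂ :=
  B319C u.1 v.1 + u.2.1 * v.2.2 + v.2.1 * u.2.2

/-- Complex conjugation on `V ⊗ ℂ`. -/
def conj420 (u : ((Fin 3 ⊕ Fin 19) → ℂ) × ℂ × ℂ) : ((Fin 3 ⊕ Fin 19) → ℂ) × ℂ × ℂ :=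
  (fun i => (starRingEnd ℂ) (u.1 i), (starRingEnd ℂ) u.2.1, (starRingEnd ℂ) u.2.2)

theorem B319_comm (x y : (Fin 3 ⊕ Fin 19) → ℝ) : B319 x y = B319 y x := by
  simp only [B319, mul_comm]

theorem B319_add_left (x y z : (Fin 3 ⊕ Fin 19) → ℝ) :
    B319 (x + y) z = B319 x z + B319 y z := by
  simp only [B319, Pi.add_apply, add_mul, Finset.sum_add_distrib]
  ring

theorem B319_smul_left (a : ℝ) (x y : (Fin 3 ⊕ Fin 19) → ℝ) :
    B319 (a • x) y = a * B319 x y := by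
  simp only [B319, Pi.smul_apply, smul_eq_mul, mul_assoc, ← Finset.mul_sum, mul_sub]

theorem B319_add_right (x y z : (Fin 3 ⊕ Fin 19) → ℝ) :
    B319 x (y + z) = B319 x y + B319 x z := by
  rw [B319_comm, B319_add_left, B319_comm y, B319_comm z]

theorem B319_smul_right (a : ℝ) (x y : (Fin 3 ⊕ Fin 19) → ℝ) :
    B319 x (a • y) = a * B319 x y := by
  rw [B319_comm, B319_smul_left, B319_comm]

theorem B319_self_nonpos {z : (Fin 3 ⊕ Fin 19) → ℝ} (hz : ∀ i, z (Sum.inl i) = 0) :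
    B319 z z ≤ 0 := by
  simp only [B319, hz, mul_zero, Finset.sum_const_zero, zero_sub, Left.neg_nonpos_iff]
  exact Finset.sum_nonneg fun j _ => mul_self_nonneg _

theorem B319C_re (x y : (Fin 3 ⊕ Fin 19) → ℂ) :
    (B319C x y).re =
      B319 (fun i => (x i).re) (fun i => (y i).re) -
        B319 (fun i => (x i).im) (fun i => (y i).im) := by
  simp only [B319C, B319, Complex.sub_re, Complex.re_sum, Complex.mul_re,
    Finset.sum_sub_distrib]
  ring

theorem B319C_im (x y : (Fin 3 ⊕ Fin 19) → ℂ) :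
    (B319C x y).im =
      B319 (fun i => (x i).re) (fun i => (y i).im) +
        B319 (fun i => (x i).im) (fun i => (y i).re) := by
  simp only [B319C, B319, Complex.sub_im, Complex.im_sum, Complex.mul_im,
    Finset.sum_add_distrib]
  ring

/-- Two orthogonal vectors of equal norm that are orthogonal to a positive-definite plane in
signature `(3,19)` cannot have positive norm, as there is no positive-definite subspace of
dimension four. -/
theorem B319_self_nonpos_of_orthogonal_plane (E : Submodule ℝ ((Fin 3 ⊕ Fin 19) → ℝ))
    (hdim : Module.finrank ℝ E = 2) (hpos : ∀ v ∈ E, v ≠ 0 → 0 < B319 v v)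
    (x y : (Fin 3 ⊕ Fin 19) → ℝ) (hxy : B319 x y = 0) (heq : B319 x x = B319 y y)
    (hx : ∀ u ∈ E, B319 x u = 0) (hy : ∀ u ∈ E, B319 y u = 0) : B319 x x ≤ 0 := by
  by_contra! hxx
  let S : (E × ℝ × ℝ) →ₗ[ℝ] ((Fin 3 ⊕ Fin 19) → ℝ) :=
    E.subtype.coprod ((LinearMap.toSpanSingleton ℝ _ x).coprod
      (LinearMap.toSpanSingleton ℝ _ y))
  let T : (E × ℝ × ℝ) →ₗ[ℝ] (Fin 3 → ℝ) := (LinearMap.funLeft ℝ ℝ Sum.inl).comp S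
  have hlt : Module.finrank ℝ (Fin 3 → ℝ) < Module.finrank ℝ (E × ℝ × ℝ) := by
    simp [hdim]
  obtain ⟨⟨u, a, b⟩, hker, hne⟩ :=
    (Submodule.ne_bot_iff _).1 (LinearMap.ker_ne_bot_of_finrank_lt (f := T) hlt)
  have hS : S (u, a, b) = (u : (Fin 3 ⊕ Fin 19) → ℝ) + (a • x + b • y) := by simp [S]
  have hle : B319 (S (u, a, b)) (S (u, a, b)) ≤ 0 :=
    B319_self_nonpos fun i => congrFun (LinearMap.mem_ker.1 hker) i
  have hxu := hx u u.2
  have hyu := hy u u.2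
  simp only [hS, B319_add_left, B319_add_right, B319_smul_left, B319_smul_right,
    B319_comm u x, B319_comm u y, B319_comm y x, hxu, hyu, hxy, ← heq] at hle
  have hu : 0 ≤ B319 u u := by
    by_cases h : (u : (Fin 3 ⊕ Fin 19) → ℝ) = 0
    · simp [h, B319]
    · exact (hpos u u.2 h).le
  have ha : a = 0 := by
    by_contra h
    nlinarith [mul_pos (sq_pos_of_ne_zero h) hxx, mul_nonneg (sq_nonneg b) hxx.le]
  have hb : b = 0 := by
    by_contra h
    nlinarith [mul_pos (sq_pos_of_ne_zero h) hxx, mul_nonneg (sq_nonneg a) hxx.le]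
  subst ha hb
  have hu0 : u ≠ 0 := by
    rintro rfl
    exact hne rfl
  have := hpos u u.2 (by simpa using hu0)
  linarith

theorem B420C_hyperbolic_coords_mul_ne_zero (E : Submodule ℝ ((Fin 3 ⊕ Fin 19) → ℝ))
    (hdim : Module.finrank ℝ E = 2)
    (hpos : ∀ v ∈ E, v ≠ 0 → 0 < B319 v v)
    (Ω : ((Fin 3 ⊕ Fin 19) → ℂ) × ℂ × ℂ)
    (h1 : B420C Ω Ω = 0)
    (h2 : 0 < B420C Ω (conj420 Ω))
    (h3 : ∀ u ∈ E, B420C Ω (fun i => ((u i : ℝ) : ℂ), 0, 0) = 0) :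
    Ω.2.1 * Ω.2.2 ≠ 0 := by
  intro h0
  have hcross : Ω.2.1 * (starRingEnd ℂ) Ω.2.2 + (starRingEnd ℂ) Ω.2.1 * Ω.2.2 = 0 := by
    rcases mul_eq_zero.1 h0 with h | h <;> simp [h]
  have hnull : B319C Ω.1 Ω.1 = 0 := by
    simpa only [B420C, h0, add_zero] using h1
  have hnorm : 0 < (B319C Ω.1 fun i => (starRingEnd ℂ) (Ω.1 i)).re := by
    have h := (Complex.lt_def.1 h2).1
    simpa only [B420C, conj420, add_assoc, hcross, add_zero, Complex.zero_re] using h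
  have hperp : ∀ u ∈ E, B319C Ω.1 (fun i => ((u i : ℝ) : ℂ)) = 0 := fun u hu => by
    simpa [B420C] using h3 u hu
  have hre := congrArg Complex.re hnull
  have him := congrArg Complex.im hnull
  rw [B319C_re, Complex.zero_re] at hre
  rw [B319C_im, B319_comm (fun i => (Ω.1 i).im), Complex.zero_im] at him
  have hneg : (fun i => -(Ω.1 i).im) = (-1 : ℝ) • fun i => (Ω.1 i).im := by
    ext i
    simp
  simp only [B319C_re, Complex.conj_re, Complex.conj_im, hneg, B319_smul_right] at hnorm
  have hle := B319_self_nonpos_of_orthogonal_plane E hdim hpos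
    (fun i => (Ω.1 i).re) (fun i => (Ω.1 i).im) (by linarith) (by linarith)
    (fun u hu => by simpa [B319C_re, B319] using congrArg Complex.re (hperp u hu))
    (fun u hu => by simpa [B319C_im, B319] using congrArg Complex.im (hperp u hu))
  linarith

/-- If `E ⊂ W` is a 2-dimensional positive-definite subspace and `Ω ∈ V ⊗ ℂ` satisfies
`⟨Ω,Ω⟩ = 0`, `⟨Ω,Ω̄⟩ > 0` and `Ω ⊥ E`, then `⟨Ω,f⟩ ≠ 0` and `⟨Ω,e⟩ ≠ 0`. -/
theorem statement16 (E : Submodule ℝ ((Fin 3 ⊕ Fin 19) → ℝ))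
    (hdim : Module.finrank ℝ E = 2)
    (hpos : ∀ v ∈ E, v ≠ 0 → 0 < B319 v v)
    (Ω : ((Fin 3 ⊕ Fin 19) → ℂ) × ℂ × ℂ)
    (h1 : B420C Ω Ω = 0)
    (h2 : 0 < B420C Ω (conj420 Ω))
    (h3 : ∀ u ∈ E, B420C Ω (fun i => ((u i : ℝ) : ℂ), 0, 0) = 0) :
    B420C Ω ((0 : (Fin 3 ⊕ Fin 19) → ℂ), 1, 0) ≠ 0 ∧
      B420C Ω ((0 : (Fin 3 ⊕ Fin 19) → ℂ), 0, 1) ≠ 0 := by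
  have h := B420C_hyperbolic_coords_mul_ne_zero E hdim hpos Ω h1 h2 h3
  exact ⟨by simpa [B420C, B319C] using right_ne_zero_of_mul h,
    by simpa [B420C, B319C] using left_ne_zero_of_mul h⟩
end
end
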